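/- Let n be a positive integer and p ∈ ℝ^n a probability vector (p_i ≥ 0, Σ_i p_i = 1). Then for every x ∈ ℝ^n, xᵀ (Diag(p) − p pᵀ) x ≤ (1/2) ‖x‖₂², where ‖x‖₂² = Σ_i x_i². Consequently, the largest eigenvalue of the symmetric positive semidefinite matrix Diag(p) − p pᵀ, and hence its spectral norm, is at most 1/2. -/

import Mathlib

open Matrix

lemma quad_form_eq (n : ℕ) (p x : Fin n → ℝ) :
    x ⬝ᵥ ((Matrix.diagonal p - Matrix.of fun i j => p i * p j).mulVec x) =
      ∑ i, p i * x i ^ 2 - (∑ i, p i * x i) ^ 2 := by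
  rw [Matrix.sub_mulVec, dotProduct_sub]
  congr 1
  · simp only [dotProduct, Matrix.mulVec_diagonal]
    exact Finset.sum_congr rfl fun i _ => by ring
  · simp only [dotProduct, Matrix.mulVec, Matrix.of_apply]
    rw [sq, Finset.sum_mul_sum]
    refine Finset.sum_congr rfl fun i _ => ?_
    rw [Finset.mul_sum]
    exact Finset.sum_congr rfl fun j _ => by ring

lemma var_bound (n : ℕ) (p x : Fin n → ℝ)
    (hp0 : ∀ i, 0 ≤ p i) (hp1 : ∑ i, p i = 1) :
    ∑ i, p i * x i ^ 2 - (∑ i, p i * x i) ^ 2 ≤ (1 / 2) * ∑ i, x i ^ 2 := by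
  have h1 : 0 ≤ ∑ i, ∑ j, (p i * p j * (x i + x j) ^ 2 -
      if i = j then 4 * (p i ^ 2 * x i ^ 2) else 0) := by
    refine Finset.sum_nonneg fun i _ => Finset.sum_nonneg fun j _ => ?_
    split_ifs with h
    · subst h
      apply le_of_eq
      ring
    · have := mul_nonneg (mul_nonneg (hp0 i) (hp0 j)) (sq_nonneg (x i + x j))
      linarith
  have h2 : ∑ i, ∑ j, p i * p j * (x i + x j) ^ 2 =
      2 * (∑ i, p i * x i ^ 2) + 2 * (∑ i, p i * x i) ^ 2 := by
    have : ∀ i j, p i * p j * (x i + x j) ^ 2 = (p i * x i ^ 2) * p j +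
        2 * ((p i * x i) * (p j * x j)) + p i * (p j * x j ^ 2) := fun i j => by ring
    simp only [this, Finset.sum_add_distrib, ← Finset.mul_sum, ← Finset.sum_mul, hp1]
    ring
  simp only [Finset.sum_sub_distrib, Finset.sum_ite_eq, Finset.mem_univ, if_true,
    ← Finset.mul_sum] at h1
  rw [h2] at h1
  have h3 : 0 ≤ ∑ i, (1 / 2 * x i ^ 2 - 2 * (p i * x i ^ 2) + 2 * (p i ^ 2 * x i ^ 2)) := by
    refine Finset.sum_nonneg fun i _ => ?_
    nlinarith [sq_nonneg (x i * (p i - 1 / 2))]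
  simp only [Finset.sum_add_distrib, Finset.sum_sub_distrib, ← Finset.mul_sum] at h3
  linarith

/-- For a probability vector `p`, the quadratic form of `Diag(p) − p pᵀ` is bounded by
`(1/2)‖x‖₂²`; consequently every eigenvalue of `Diag(p) − p pᵀ` (hence its spectral norm,
being symmetric positive semidefinite) is at most `1/2`. -/
theorem diag_sub_outer_spectral_bound
    (n : ℕ) (hn : 0 < n) (p : Fin n → ℝ)
    (hp0 : ∀ i, 0 ≤ p i) (hp1 : ∑ i, p i = 1) :
    (∀ x : Fin n → ℝ,
      x ⬝ᵥ ((Matrix.diagonal p - Matrix.of fun i j => p i * p j).mulVec x) ≤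
        (1 / 2) * ∑ i, x i ^ 2) ∧
    (∀ (μ : ℝ) (x : Fin n → ℝ), x ≠ 0 →
      (Matrix.diagonal p - Matrix.of fun i j => p i * p j).mulVec x = μ • x →
      μ ≤ 1 / 2) := by
  have key : ∀ x : Fin n → ℝ,
      x ⬝ᵥ ((Matrix.diagonal p - Matrix.of fun i j => p i * p j).mulVec x) ≤
        (1 / 2) * ∑ i, x i ^ 2 := fun x => by
    rw [quad_form_eq]
    exact var_bound n p x hp0 hp1
  refine ⟨key, fun μ x hx h => ?_⟩
  have hk := key x
  rw [h, dotProduct_smul, smul_eq_mul] at hk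
  have he : x ⬝ᵥ x = ∑ i, x i ^ 2 := by
    simp only [dotProduct, sq]
  rw [he] at hk
  have hpos : 0 < ∑ i, x i ^ 2 := by
    obtain ⟨i, hi⟩ := Function.ne_iff.mp hx
    exact Finset.sum_pos' (fun i _ => sq_nonneg _) ⟨i, Finset.mem_univ i, sq_pos_of_ne_zero hi⟩
  exact le_of_mul_le_mul_right hk hpos
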